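/- arXiv:1109.1668 — 4 statements merged into one kernel-verified Lean document; each statement's English description precedes it below -/
import Mathlib

section
/- If a, b ∈ V satisfy q(a) = q(b) = q(a+b) = 0 (in ZMod 4), then the composite T_a ∘ T_b ∘ T_{a+b} preserves q; that is, q((T_a ∘ T_b ∘ T_{a+b})(v)) = q(v) for all v ∈ V, so T_a ∘ T_b ∘ T_{a+b} ∈ O_g(q). -/
/-- `V = H₁(N_g; ℤ/2)` as the space of `ℤ/2`-vectors of length `g`.
The standard basis vector `x_i` (1-based index `i`) is `basis_x g ⟨i-1, _⟩`. -/
abbrev Vg (g : ℕ) := Fin g → ZMod 2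

/-- The standard basis vector (0-based index). -/
def basis_x (g : ℕ) (i : Fin g) : Vg g := Pi.single i 1

/-- The mod-2 intersection form `B(v,w) = ∑ᵢ vᵢ wᵢ`. -/
def Bform (g : ℕ) (v w : Vg g) : ZMod 2 := ∑ i, v i * w i

/-- The number of odd 1-based indices `i` with `vᵢ = 1` (0-based: even indices). -/
def lenOdd (g : ℕ) (v : Vg g) : ℕ :=
  (Finset.univ.filter fun i : Fin g => v i = 1 ∧ i.val % 2 = 0).card

/-- The number of even 1-based indices `i` with `vᵢ = 1` (0-based: odd indices). -/
def lenEven (g : ℕ) (v : Vg g) : ℕ :=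
  (Finset.univ.filter fun i : Fin g => v i = 1 ∧ i.val % 2 = 1).card

/-- The Guillou–Marin quadratic form of the o-standardly embedded `N_g`. -/
def qform (g : ℕ) (v : Vg g) : ZMod 4 := (lenOdd g v : ZMod 4) - (lenEven g v : ZMod 4)

/-- The transvection `T_a : v ↦ v + B(v,a)·a`, as a linear endomorphism of `V`. -/
def Tv (g : ℕ) (a : Vg g) : Module.End (ZMod 2) (Vg g) where
  toFun v := v + Bform g v a • a
  map_add' v w := by
    have h : Bform g (v + w) a = Bform g v a + Bform g w a := by
      simp [Bform, add_mul, Finset.sum_add_distrib]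
    simp only [h, add_smul]
    abel
  map_smul' c v := by
    have h : Bform g (c • v) a = c * Bform g v a := by
      simp [Bform, Finset.mul_sum, mul_assoc]
    simp only [h, RingHom.id_apply, mul_smul, smul_add]

/-- The additive map `ℤ/2 → ℤ/4` given by multiplication by two. -/
def doubling : ZMod 2 →+ ZMod 4 where
  toFun x := 2 * (x.val : ZMod 4)
  map_zero' := by decide
  map_add' := by decide

lemma doubling_eq_zero : ∀ {x : ZMod 2}, doubling x = 0 → x = 0 := by decide

lemma Bform_comm (g : ℕ) (v w : Vg g) : Bform g v w = Bform g w v := by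
  simp [Bform, mul_comm]

lemma Bform_add_left (g : ℕ) (u v w : Vg g) :
    Bform g (u + v) w = Bform g u w + Bform g v w := by
  simp [Bform, add_mul, Finset.sum_add_distrib]

lemma Bform_smul_left (g : ℕ) (c : ZMod 2) (v w : Vg g) :
    Bform g (c • v) w = c * Bform g v w := by
  simp [Bform, Finset.mul_sum, mul_assoc]

lemma Bform_add_right (g : ℕ) (u v w : Vg g) :
    Bform g u (v + w) = Bform g u v + Bform g u w := by
  simp only [Bform_comm g u, Bform_add_left]

lemma Bform_smul_right (g : ℕ) (c : ZMod 2) (v w : Vg g) :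
    Bform g v (c • w) = c * Bform g v w := by
  simp only [Bform_comm g v, Bform_smul_left]

lemma Tv_apply (g : ℕ) (a v : Vg g) : Tv g a v = v + Bform g v a • a := rfl

lemma qform_zero (g : ℕ) : qform g 0 = 0 := by
  simp [qform, lenOdd, lenEven]

lemma qform_eq_sum (g : ℕ) (v : Vg g) :
    qform g v = ∑ i, (if i.val % 2 = 0 then 1 else -1) * ((v i).val : ZMod 4) := by
  simp only [qform, lenOdd, lenEven, Finset.natCast_card_filter, ← Finset.sum_sub_distrib]
  refine Finset.sum_congr rfl fun i _ => ?_
  generalize v i = x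
  rcases Nat.mod_two_eq_zero_or_one i.val with h | h <;> simp only [h] <;>
    revert x <;> decide

lemma qform_add (g : ℕ) (v w : Vg g) :
    qform g (v + w) = qform g v + qform g w + doubling (Bform g v w) := by
  simp only [qform_eq_sum, Bform, map_sum, ← Finset.sum_add_distrib]
  refine Finset.sum_congr rfl fun i _ => ?_
  simp only [Pi.add_apply]
  generalize v i = x, w i = y
  split_ifs <;> revert x y <;> decide

lemma qform_smul (g : ℕ) (c : ZMod 2) {a : Vg g} (ha : qform g a = 0) :
    qform g (c • a) = 0 := by
  obtain rfl | rfl : c = 0 ∨ c = 1 := by revert c; decide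
  · rw [zero_smul, qform_zero]
  · rwa [one_smul]

lemma Bform_self_of_qform_eq_zero (g : ℕ) {a : Vg g} (ha : qform g a = 0) :
    Bform g a a = 0 := by
  have h := qform_add g a a
  rw [ZModModule.add_self, qform_zero, ha, zero_add, zero_add] at h
  exact doubling_eq_zero h.symm

lemma Bform_eq_zero_of_qform_eq_zero (g : ℕ) {a b : Vg g}
    (ha : qform g a = 0) (hb : qform g b = 0) (hab : qform g (a + b) = 0) :
    Bform g a b = 0 := by
  rw [qform_add, ha, hb, zero_add, zero_add] at hab
  exact doubling_eq_zero hab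

lemma Tv_mul_Tv_mul_Tv_add_apply (g : ℕ) {a b : Vg g} (haa : Bform g a a = 0)
    (hbb : Bform g b b = 0) (hab : Bform g a b = 0) (v : Vg g) :
    (Tv g a * Tv g b * Tv g (a + b)) v = v + (Bform g v b • a + Bform g v a • b) := by
  have hba : Bform g b a = 0 := by rw [Bform_comm, hab]
  simp only [Module.End.mul_apply, Tv_apply, Bform_add_left, Bform_add_right, Bform_smul_left,
    haa, hbb, hab, hba, mul_zero, add_zero]
  ext i
  simp only [Pi.add_apply, Pi.smul_apply, smul_eq_mul]
  generalize Bform g v a = x, Bform g v b = y, v i = t, a i = r, b i = s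
  linear_combination CharTwo.add_self_eq_zero (x * r) + CharTwo.add_self_eq_zero (y * s)

/-- If `q(a) = q(b) = q(a+b) = 0` then `T_a ∘ T_b ∘ T_{a+b}` preserves `q`. -/
theorem stmt8 (g : ℕ) (hg : 1 ≤ g) (a b : Vg g)
    (ha : qform g a = 0) (hb : qform g b = 0) (hab : qform g (a + b) = 0) :
    ∀ v, qform g ((Tv g a * Tv g b * Tv g (a + b)) v) = qform g v := by
  intro v
  have hB := Bform_eq_zero_of_qform_eq_zero g ha hb hab
  rw [Tv_mul_Tv_mul_Tv_add_apply g (Bform_self_of_qform_eq_zero g ha)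
    (Bform_self_of_qform_eq_zero g hb) hB, qform_add, qform_add, qform_smul g _ ha,
    qform_smul g _ hb, Bform_add_right]
  simp only [Bform_smul_right, Bform_smul_left, hB, mul_zero, map_zero, add_zero,
    mul_comm (Bform g v b) (Bform g v a), CharTwo.add_self_eq_zero]
end

section
/- For every v ∈ V there exists an element T of the subgroup of GL(V) generated by the transvections T_{x_i + x_{i+2}} (1 ≤ i ≤ g−2) such that T(v) = x_1 + x_3 + ⋯ + x_{2·l_o(v)−1} + x_2 + x_4 + ⋯ + x_{2·l_e(v)}; that is, T(v) is the sum of the first l_o(v) odd-indexed standard basis vectors and the first l_e(v) even-indexed standard basis vectors. -/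
/-- Only the transvections `T_{x_i + x_{i+2}}`. -/
def genSet1 (g : ℕ) : Set (Module.End (ZMod 2) (Vg g))ˣ :=
  {u | ∃ i : ℕ, ∃ h : i + 2 < g,
    (u : Module.End (ZMod 2) (Vg g)) =
      Tv g (basis_x g ⟨i, by omega⟩ + basis_x g ⟨i + 2, h⟩)}

/-- The vector `x_1 + x_3 + ⋯ + x_{2·l_o(v)-1} + x_2 + x_4 + ⋯ + x_{2·l_e(v)}`
(1-based indices): the sum of the first `l_o(v)` odd-indexed and the first
`l_e(v)` even-indexed standard basis vectors. -/
def normalForm (g : ℕ) (v : Vg g) : Vg g := fun i =>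
  if i.val % 2 = 0 then (if i.val / 2 < lenOdd g v then 1 else 0)
  else (if i.val / 2 < lenEven g v then 1 else 0)

/-- The transvection along `x_a + x_b` exchanges the coordinates `a` and `b`. -/
theorem Tv_add_basis_apply (g : ℕ) {a b : Fin g} (hab : a ≠ b) (v : Vg g) :
    Tv g (basis_x g a + basis_x g b) v = v ∘ Equiv.swap a b := by
  have hB : Bform g v (basis_x g a + basis_x g b) = v a + v b := by
    simp [Bform, basis_x, mul_add, Finset.sum_add_distrib, Pi.single_apply]
  funext j
  change v j + (Bform g v (basis_x g a + basis_x g b) • (basis_x g a + basis_x g b)) j =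
    v (Equiv.swap a b j)
  rw [hB]
  have h2 : ∀ x y : ZMod 2, x + (x + y) = y ∧ x + (y + x) = y := by decide
  by_cases ha : j = a
  · subst ha
    simp [basis_x, hab, h2]
  · by_cases hb : j = b
    · subst hb
      simp [basis_x, ha, h2]
    · simp [basis_x, ha, hb, Equiv.swap_apply_of_ne_of_ne]

theorem exists_mem_genSet1_apply_eq_comp_swap (g i : ℕ) (h : i + 2 < g) :
    ∃ u ∈ genSet1 g, ∀ v : Vg g, (u : Module.End (ZMod 2) (Vg g)) v =
      v ∘ Equiv.swap (⟨i, by omega⟩ : Fin g) ⟨i + 2, h⟩ := by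
  have hne : (⟨i, by omega⟩ : Fin g) ≠ ⟨i + 2, h⟩ := by simp
  have hsq : Tv g (basis_x g ⟨i, by omega⟩ + basis_x g ⟨i + 2, h⟩) *
      Tv g (basis_x g ⟨i, by omega⟩ + basis_x g ⟨i + 2, h⟩) = 1 := by
    refine LinearMap.ext fun v => ?_
    rw [Module.End.mul_apply, Tv_add_basis_apply g hne, Tv_add_basis_apply g hne]
    funext j
    simp
  exact ⟨⟨_, _, hsq, hsq⟩, ⟨i, h, rfl⟩, Tv_add_basis_apply g hne⟩

theorem card_filter_comp_perm {g : ℕ} (σ : Equiv.Perm (Fin g)) (v : Vg g) (r : ℕ)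
    (hσ : ∀ i, (σ i).val % 2 = i.val % 2) :
    (Finset.univ.filter fun i : Fin g => (v ∘ σ) i = 1 ∧ i.val % 2 = r).card =
      (Finset.univ.filter fun i : Fin g => v i = 1 ∧ i.val % 2 = r).card :=
  Finset.card_equiv σ fun i => by simp [hσ]

theorem normalForm_comp_perm {g : ℕ} (σ : Equiv.Perm (Fin g)) (v : Vg g)
    (hσ : ∀ i, (σ i).val % 2 = i.val % 2) : normalForm g (v ∘ σ) = normalForm g v := by
  have ho : lenOdd g (v ∘ σ) = lenOdd g v := card_filter_comp_perm σ v 0 hσ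
  have he : lenEven g (v ∘ σ) = lenEven g v := card_filter_comp_perm σ v 1 hσ
  funext i
  simp only [normalForm, ho, he]

theorem eq_one_of_add_two_mul {g : ℕ} {v : Vg g}
    (hv : ∀ i (h : i + 2 < g), v ⟨i + 2, h⟩ = 1 → v ⟨i, by omega⟩ = 1) (i k : ℕ)
    (h : i + 2 * k < g) (hk : v ⟨i + 2 * k, h⟩ = 1) : v ⟨i, by omega⟩ = 1 := by
  induction k with
  | zero => exact hk
  | succ k ih => exact ih (by omega) (hv (i + 2 * k) h hk)

theorem half_lt_card_filter_iff {g : ℕ} {v : Vg g}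
    (hv : ∀ i (h : i + 2 < g), v ⟨i + 2, h⟩ = 1 → v ⟨i, by omega⟩ = 1) (i : Fin g) :
    i.val / 2 < (Finset.univ.filter fun j : Fin g => v j = 1 ∧ j.val % 2 = i.val % 2).card ↔
      v i = 1 := by
  have hdown : ∀ j k : Fin g, j.val ≤ k.val → j.val % 2 = k.val % 2 → v k = 1 → v j = 1 := by
    intro j k hjk hmod hk
    have hval : j.val + 2 * ((k.val - j.val) / 2) = k.val := by omega
    refine eq_one_of_add_two_mul hv j.val ((k.val - j.val) / 2) (by omega) ?_
    rwa [show (⟨_, _⟩ : Fin g) = k from Fin.ext hval]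
  set S := Finset.univ.filter fun j : Fin g => v j = 1 ∧ j.val % 2 = i.val % 2 with hS
  have hcard : (S.image fun j => j.val / 2).card = S.card := by
    refine Finset.card_image_of_injOn fun a ha b hb hab => Fin.ext ?_
    simp only [hS, Finset.coe_filter, Finset.mem_univ, true_and, Set.mem_ofPred_eq] at ha hb hab
    omega
  rw [← hcard]
  constructor
  · contrapose!
    intro hi
    refine (Finset.card_le_card (t := Finset.range (i.val / 2)) ?_).trans_eq
      (Finset.card_range _)
    intro m hm
    simp only [hS, Finset.mem_image, Finset.mem_filter, Finset.mem_univ, true_and] at hm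
    obtain ⟨j, ⟨hj, hmod⟩, rfl⟩ := hm
    rw [Finset.mem_range]
    by_contra hlt
    exact hi (hdown i j (by omega) hmod.symm hj)
  · intro hi
    rw [Nat.lt_iff_add_one_le]
    refine (Finset.card_range _).symm.trans_le (Finset.card_le_card ?_)
    intro m hm
    rw [Finset.mem_range] at hm
    simp only [hS, Finset.mem_image, Finset.mem_filter, Finset.mem_univ, true_and]
    refine ⟨⟨2 * m + i.val % 2, by omega⟩, ⟨hdown _ i ?_ ?_ hi, ?_⟩, ?_⟩ <;> dsimp only <;> omega

/-- A vector whose support is an initial segment within each parity class is its normal form. -/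
theorem eq_normalForm {g : ℕ} {v : Vg g}
    (hv : ∀ i (h : i + 2 < g), v ⟨i + 2, h⟩ = 1 → v ⟨i, by omega⟩ = 1) :
    v = normalForm g v := by
  have h2 : ∀ x : ZMod 2, x = if x = 1 then 1 else 0 := by decide
  funext i
  have key := half_lt_card_filter_iff hv i
  rw [normalForm]
  split_ifs with h0 h1 h1
  · rw [h0] at key
    exact key.1 h1
  · rw [h0] at key
    rw [h2 (v i), if_neg fun h => h1 (key.2 h)]
  · rw [show i.val % 2 = 1 by omega] at key
    exact key.1 h1
  · rw [show i.val % 2 = 1 by omega] at key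
    rw [h2 (v i), if_neg fun h => h1 (key.2 h)]

theorem sum_mul_val_comp_swap_lt {g : ℕ} {v : Vg g} {a b : Fin g} (hab : a < b)
    (ha : v a = 0) (hb : v b = 1) :
    ∑ i : Fin g, i.val * ((v ∘ Equiv.swap a b) i).val < ∑ i : Fin g, i.val * (v i).val := by
  have hsum : ∑ i : Fin g, i.val * ((v ∘ Equiv.swap a b) i).val =
      ∑ i : Fin g, (Equiv.swap a b i).val * (v i).val := by
    rw [← Equiv.sum_comp (Equiv.swap a b)]
    simp
  rw [hsum]
  refine Finset.sum_lt_sum (fun i _ => ?_) ⟨b, Finset.mem_univ b, ?_⟩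
  · by_cases hia : i = a
    · simp [hia, ha]
    · by_cases hib : i = b
      · subst hib
        simpa using Nat.mul_le_mul_right _ hab.le
      · rw [Equiv.swap_apply_of_ne_of_ne hia hib]
  · simpa [hb, ZMod.val_one] using hab

/-- Every `v` can be moved to its normal form by the group generated by the
transvections `T_{x_i + x_{i+2}}`. -/
theorem stmt10 (g : ℕ) (hg : 1 ≤ g) (v : Vg g) :
    ∃ u ∈ Subgroup.closure (genSet1 g),
      (u : Module.End (ZMod 2) (Vg g)) v = normalForm g v := by
  induction hn : ∑ i : Fin g, i.val * (v i).val using Nat.strong_induction_on generalizing v with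
  | _ n ih =>
    subst hn
    by_cases hv : ∀ i (h : i + 2 < g), v ⟨i + 2, h⟩ = 1 → v ⟨i, by omega⟩ = 1
    · exact ⟨1, one_mem _, eq_normalForm hv⟩
    · push Not at hv
      obtain ⟨i, h, hb, ha⟩ := hv
      have h2 : ∀ x : ZMod 2, x ≠ 1 → x = 0 := by decide
      obtain ⟨t, ht, htv⟩ := exists_mem_genSet1_apply_eq_comp_swap g i h
      obtain ⟨u, hu, huv⟩ := ih _ (sum_mul_val_comp_swap_lt (by simp) (h2 _ ha) hb) _ rfl
      refine ⟨u * t, mul_mem hu (Subgroup.subset_closure ht), ?_⟩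
      rw [Units.val_mul, Module.End.mul_apply, htv, huv]
      refine normalForm_comp_perm _ v fun j => ?_
      rw [Equiv.swap_apply_def]
      split_ifs with h1 h1 <;> simp [h1]
end

section
/- Two vectors v, w ∈ V lie in the same orbit under the subgroup of GL(V) generated by the transvections T_{x_i + x_{i+2}} (1 ≤ i ≤ g−2) if and only if l_o(v) = l_o(w) and l_e(v) = l_e(w). -/
/-- The action of permutations of the index set on `V` by permuting coordinates. -/
def permRep (g : ℕ) : Equiv.Perm (Fin g) →* (Module.End (ZMod 2) (Vg g))ˣ :=
  MonoidHom.toHomUnits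
    { toFun := fun σ => LinearMap.funLeft (ZMod 2) (ZMod 2) ⇑σ⁻¹
      map_one' := rfl
      map_mul' := fun σ τ => by
        ext v i
        simp [LinearMap.funLeft] }

theorem permRep_apply (g : ℕ) (σ : Equiv.Perm (Fin g)) (v : Vg g) (i : Fin g) :
    (permRep g σ : Module.End (ZMod 2) (Vg g)) v i = v (σ⁻¹ i) := rfl

/-- The transpositions exchanging the indices `i` and `i + 2`. -/
def swapSet (g : ℕ) : Set (Equiv.Perm (Fin g)) :=
  {σ | ∃ i : ℕ, ∃ h : i + 2 < g, σ = Equiv.swap ⟨i, by omega⟩ ⟨i + 2, h⟩}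

/-- The transvection along `x_a + x_b` exchanges the coordinates `a` and `b`. -/
theorem permRep_swap (g : ℕ) {a b : Fin g} (hab : a ≠ b) :
    (permRep g (Equiv.swap a b) : Module.End (ZMod 2) (Vg g)) =
      Tv g (basis_x g a + basis_x g b) := by
  refine LinearMap.ext fun v => funext fun i => ?_
  have hB : Bform g v (basis_x g a + basis_x g b) = v a + v b := by
    simp [Bform, basis_x, mul_add, Finset.sum_add_distrib, Pi.single_apply]
  have hT : Tv g (basis_x g a + basis_x g b) v i =
      v i + (v a + v b) * (basis_x g a i + basis_x g b i) := by
    rw [← hB]; rfl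
  rw [permRep_apply, hT, Equiv.swap_inv]
  by_cases hia : i = a
  · subst hia
    simp only [Equiv.swap_apply_left, basis_x, Pi.single_apply, hab, if_true, if_false]
    linear_combination -CharTwo.add_self_eq_zero (v i)
  · by_cases hib : i = b
    · subst hib
      simp only [Equiv.swap_apply_right, basis_x, Pi.single_apply, hia, if_true, if_false]
      linear_combination -CharTwo.add_self_eq_zero (v i)
    · simp [Equiv.swap_apply_of_ne_of_ne hia hib, basis_x, hia, hib]

theorem genSet1_eq_image (g : ℕ) : genSet1 g = permRep g '' swapSet g := by
  have hne (i : ℕ) (h : i + 2 < g) : (⟨i, by omega⟩ : Fin g) ≠ ⟨i + 2, h⟩ := by simp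
  ext u
  constructor
  · rintro ⟨i, h, hu⟩
    exact ⟨_, ⟨i, h, rfl⟩, Units.ext ((permRep_swap g (hne i h)).trans hu.symm)⟩
  · rintro ⟨_, ⟨i, h, rfl⟩, rfl⟩
    exact ⟨i, h, permRep_swap g (hne i h)⟩

theorem mem_orbit_closure_swapSet (g : ℕ) (i : Fin g) (k : ℕ) (h : i.val + 2 * k < g) :
    (⟨i.val + 2 * k, h⟩ : Fin g) ∈ MulAction.orbit (Subgroup.closure (swapSet g)) i := by
  induction k with
  | zero => exact MulAction.mem_orbit_self i
  | succ k ih =>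
    obtain ⟨σ, hσ⟩ := ih (by omega)
    have hs : Equiv.swap (⟨i.val + 2 * k, by omega⟩ : Fin g) ⟨i.val + 2 * k + 2, by omega⟩ ∈
        Subgroup.closure (swapSet g) :=
      Subgroup.subset_closure ⟨i.val + 2 * k, by omega, rfl⟩
    refine ⟨⟨_, hs⟩ * σ, ?_⟩
    simp only [mul_smul] at hσ ⊢
    rw [hσ]
    exact Equiv.swap_apply_left _ _

/-- The group generated by the transpositions `(i, i + 2)` consists of the permutations
preserving the parity of indices. -/
theorem mem_closure_swapSet_iff (g : ℕ) (σ : Equiv.Perm (Fin g)) :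
    σ ∈ Subgroup.closure (swapSet g) ↔ ∀ i, (σ i).val % 2 = i.val % 2 := by
  constructor
  · intro hσ
    induction hσ using Subgroup.closure_induction with
    | mem σ hσ =>
      obtain ⟨k, h, rfl⟩ := hσ
      intro i
      rw [Equiv.swap_apply_def]
      split_ifs with h₁ h₂
      · simp [h₁]
      · simp [h₂]
      · rfl
    | one => exact fun _ => rfl
    | mul σ τ _ _ hσ hτ => exact fun i => (hσ (τ i)).trans (hτ i)
    | inv σ _ hσ =>
      intro i
      have := hσ (σ⁻¹ i)
      simpa using this.symm
  · intro hσ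
    have hS : ∀ τ ∈ swapSet g, τ.IsSwap := by
      rintro _ ⟨i, h, rfl⟩
      exact ⟨_, _, by simp, rfl⟩
    refine (mem_closure_isSwap hS).2 ⟨Set.toFinite _, fun i => ?_⟩
    have hi := hσ i
    rcases le_total i.val (σ i).val with hle | hle
    · have e : i.val + 2 * (((σ i).val - i.val) / 2) = (σ i).val := by omega
      have := mem_orbit_closure_swapSet g i (((σ i).val - i.val) / 2) (by omega)
      rwa [show (⟨_, _⟩ : Fin g) = σ i from Fin.ext e] at this
    · have e : (σ i).val + 2 * ((i.val - (σ i).val) / 2) = i.val := by omega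
      have := mem_orbit_closure_swapSet g (σ i) ((i.val - (σ i).val) / 2) (by omega)
      rw [show (⟨_, _⟩ : Fin g) = i from Fin.ext e] at this
      exact MulAction.mem_orbit_symm.1 this

/-- Parity-preserving permutations of the coordinates preserve the number of indices of given
parity at which a vector takes the value `1`. -/
theorem card_filter_perm (g : ℕ) (σ : Equiv.Perm (Fin g))
    (hσ : ∀ i, (σ i).val % 2 = i.val % 2) (v : Vg g) (r : ℕ) :
    (Finset.univ.filter fun i : Fin g => v i = 1 ∧ i.val % 2 = r).card =
      (Finset.univ.filter fun i : Fin g => v (σ⁻¹ i) = 1 ∧ i.val % 2 = r).card :=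
  Finset.card_equiv σ fun i => by simp [hσ]

theorem card_filter_eq_zero_add_one (g : ℕ) (v : Vg g) (r : ℕ) :
    (Finset.univ.filter fun i : Fin g => v i = 0 ∧ i.val % 2 = r).card +
      (Finset.univ.filter fun i : Fin g => v i = 1 ∧ i.val % 2 = r).card =
      (Finset.univ.filter fun i : Fin g => i.val % 2 = r).card := by
  rw [← Finset.card_union_of_disjoint]
  · congr 1
    ext i
    have h : v i = 0 ∨ v i = 1 := by generalize v i = x; revert x; decide
    simp only [Finset.mem_union, Finset.mem_filter, Finset.mem_univ, true_and]
    tauto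
  · rw [Finset.disjoint_filter]
    rintro i - ⟨h0, -⟩ ⟨h1, -⟩
    exact zero_ne_one (h0.symm.trans h1)

/-- Vectors with equal odd and even lengths differ by a parity-preserving permutation. -/
theorem exists_perm_of_length_eq (g : ℕ) (v w : Vg g)
    (ho : lenOdd g v = lenOdd g w) (he : lenEven g v = lenEven g w) :
    ∃ σ : Equiv.Perm (Fin g), (∀ i, (σ i).val % 2 = i.val % 2) ∧ ∀ i, w (σ i) = v i := by
  have h1 (r : ℕ) : (Finset.univ.filter fun i : Fin g => v i = 1 ∧ i.val % 2 = r).card =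
      (Finset.univ.filter fun i : Fin g => w i = 1 ∧ i.val % 2 = r).card := by
    match r with
    | 0 => exact ho
    | 1 => exact he
    | r + 2 =>
      have hr (n : ℕ) : n % 2 ≠ r + 2 := by omega
      simp [hr]
  have hc (c : ZMod 2 × ℕ) :
      Nonempty ({i : Fin g // (v i, i.val % 2) = c} ≃ {i : Fin g // (w i, i.val % 2) = c}) := by
    obtain ⟨x, r⟩ := c
    rw [← Fintype.card_eq, Fintype.card_subtype, Fintype.card_subtype]
    simp only [Prod.mk.injEq]
    have hx : x = 0 ∨ x = 1 := by revert x; decide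
    rcases hx with rfl | rfl
    · have hv := card_filter_eq_zero_add_one g v r
      have hw := card_filter_eq_zero_add_one g w r
      have := h1 r
      omega
    · exact h1 r
  let σ : Equiv.Perm (Fin g) := Equiv.ofFiberEquiv fun c => (hc c).some
  have hσ (i : Fin g) : (w (σ i), (σ i).val % 2) = (v i, i.val % 2) :=
    Equiv.ofFiberEquiv_map (g := fun i : Fin g => (w i, i.val % 2)) (fun c => (hc c).some) i
  exact ⟨σ, fun i => (Prod.ext_iff.1 (hσ i)).2, fun i => (Prod.ext_iff.1 (hσ i)).1⟩

/-- Two vectors are in the same orbit under the group generated by the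
transvections `T_{x_i + x_{i+2}}` iff they have the same odd and even lengths. -/
theorem stmt11 (g : ℕ) (hg : 1 ≤ g) (v w : Vg g) :
    (∃ u ∈ Subgroup.closure (genSet1 g),
      (u : Module.End (ZMod 2) (Vg g)) v = w) ↔
    (lenOdd g v = lenOdd g w ∧ lenEven g v = lenEven g w) := by
  rw [genSet1_eq_image, ← MonoidHom.map_closure]
  constructor
  · rintro ⟨_, ⟨σ, hσ, rfl⟩, rfl⟩
    have hp := (mem_closure_swapSet_iff g σ).1 hσ
    exact ⟨card_filter_perm g σ hp v 0, card_filter_perm g σ hp v 1⟩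
  · rintro ⟨ho, he⟩
    obtain ⟨σ, hp, hσ⟩ := exists_perm_of_length_eq g v w ho he
    refine ⟨permRep g σ, ⟨σ, (mem_closure_swapSet_iff g σ).2 hp, rfl⟩, funext fun i => ?_⟩
    rw [permRep_apply, ← hσ]
    simp
end

section
/- If a ∈ V satisfies q(a) = 2 (in ZMod 4), then the transvection T_a lies in the subgroup of GL(V) generated by the transvections T_{x_i + x_{i+2}} (1 ≤ i ≤ g−2) and the composites T_{x_i + x_{i+1}} ∘ T_{x_{i+2} + x_{i+3}} ∘ T_{x_i + x_{i+1} + x_{i+2} + x_{i+3}} (1 ≤ i ≤ g−3). -/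
/-- The generating set of `O_g(q)` from Theorem 4.2: the transvections
`T_{x_i + x_{i+2}}` (1-based `1 ≤ i ≤ g-2`, here 0-based) and the composites
`T_{x_i + x_{i+1}} ∘ T_{x_{i+2} + x_{i+3}} ∘ T_{x_i + x_{i+1} + x_{i+2} + x_{i+3}}`
(1-based `1 ≤ i ≤ g-3`). -/
def genSet (g : ℕ) : Set (Module.End (ZMod 2) (Vg g))ˣ :=
  {u | ∃ i : ℕ, ∃ h : i + 2 < g,
    (u : Module.End (ZMod 2) (Vg g)) =
      Tv g (basis_x g ⟨i, by omega⟩ + basis_x g ⟨i + 2, h⟩)} ∪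
  {u | ∃ i : ℕ, ∃ h : i + 3 < g,
    (u : Module.End (ZMod 2) (Vg g)) =
      Tv g (basis_x g ⟨i, by omega⟩ + basis_x g ⟨i + 1, by omega⟩) *
      Tv g (basis_x g ⟨i + 2, by omega⟩ + basis_x g ⟨i + 3, h⟩) *
      Tv g (basis_x g ⟨i, by omega⟩ + basis_x g ⟨i + 1, by omega⟩ +
            basis_x g ⟨i + 2, by omega⟩ + basis_x g ⟨i + 3, h⟩)}

lemma Bform_basis_right (g : ℕ) (v : Vg g) (i : Fin g) : Bform g v (basis_x g i) = v i := by
  simp [Bform, basis_x, Pi.single_apply]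

lemma basis_x_apply (g : ℕ) (i j : Fin g) : basis_x g i j = if j = i then 1 else 0 :=
  Pi.single_apply i 1 j

lemma Vg_add_self (g : ℕ) (v : Vg g) : v + v = 0 := by
  ext i
  exact CharTwo.add_self_eq_zero (v i)

lemma Vg_add_add_cancel (g : ℕ) (v w : Vg g) : v + w + w = v := by
  rw [add_assoc, Vg_add_self, add_zero]

lemma Tv_zero (g : ℕ) : Tv g 0 = 1 := by
  apply LinearMap.ext
  intro v
  simp [Tv_apply]

lemma Tv_mul_self (g : ℕ) (a : Vg g) (ha : Bform g a a = 0) : Tv g a * Tv g a = 1 := by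
  apply LinearMap.ext
  intro v
  simp only [Module.End.mul_apply, Tv_apply, Bform_add_left, Bform_smul_left, ha, mul_zero,
    add_zero, Vg_add_add_cancel, Module.End.one_apply]

/-- The transvection along a vector `a` with `B(a,a) = 0`, as a unit. -/
def TvUnit (g : ℕ) (a : Vg g) (ha : Bform g a a = 0) : (Module.End (ZMod 2) (Vg g))ˣ :=
  ⟨Tv g a, Tv g a, Tv_mul_self g a ha, Tv_mul_self g a ha⟩

/-- `f` preserves the form `B`. -/
def IsBIsometry (g : ℕ) (f : Module.End (ZMod 2) (Vg g)) : Prop :=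
  ∀ v w, Bform g (f v) (f w) = Bform g v w

lemma IsBIsometry.mul {g : ℕ} {f h : Module.End (ZMod 2) (Vg g)} (hf : IsBIsometry g f)
    (hh : IsBIsometry g h) : IsBIsometry g (f * h) :=
  fun v w => (hf _ _).trans (hh v w)

lemma isBIsometry_Tv (g : ℕ) (a : Vg g) (ha : Bform g a a = 0) : IsBIsometry g (Tv g a) := by
  intro v w
  simp only [Tv_apply, Bform_add_left, Bform_smul_left, Bform_add_right, Bform_smul_right, ha,
    Bform_comm g a w, mul_zero, add_zero]
  rw [add_assoc, mul_comm (Bform g v a), CharTwo.add_self_eq_zero, add_zero]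

lemma IsBIsometry.mul_Tv {g : ℕ} {f : Module.End (ZMod 2) (Vg g)} (hf : IsBIsometry g f)
    (a : Vg g) : f * Tv g a = Tv g (f a) * f := by
  apply LinearMap.ext
  intro v
  simp [Module.End.mul_apply, Tv_apply, hf v a]

/-- `f` is the underlying endomorphism of an element of the group generated by `genSet g`. -/
def InGenGroup (g : ℕ) (f : Module.End (ZMod 2) (Vg g)) : Prop :=
  ∃ u ∈ Subgroup.closure (genSet g), (u : Module.End (ZMod 2) (Vg g)) = f

lemma InGenGroup.one (g : ℕ) : InGenGroup g 1 := ⟨1, one_mem _, rfl⟩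

lemma InGenGroup.congr_of_semiconj {g : ℕ} {f h k : Module.End (ZMod 2) (Vg g)}
    (hf : InGenGroup g f) (e : f * h = k * f) : InGenGroup g h ↔ InGenGroup g k := by
  obtain ⟨u, hu, rfl⟩ := hf
  constructor
  · rintro ⟨v, hv, rfl⟩
    exact ⟨u * v * u⁻¹, mul_mem (mul_mem hu hv) (inv_mem hu), by simp [e]⟩
  · rintro ⟨v, hv, rfl⟩
    exact ⟨u⁻¹ * v * u, mul_mem (mul_mem (inv_mem hu) hv) hu, by simp [← e, mul_assoc]⟩

lemma InGenGroup.Tv_iff {g : ℕ} {f : Module.End (ZMod 2) (Vg g)} (hf : InGenGroup g f)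
    (hB : IsBIsometry g f) (a : Vg g) : InGenGroup g (Tv g a) ↔ InGenGroup g (Tv g (f a)) :=
  hf.congr_of_semiconj (hB.mul_Tv a)

lemma Bform_basis_pair_self (g : ℕ) (i j : Fin g) :
    Bform g (basis_x g i + basis_x g j) (basis_x g i + basis_x g j) = 0 := by
  rw [Bform_add_right, Bform_basis_right, Bform_basis_right]
  by_cases h : i = j
  · simp [basis_x_apply, h, CharTwo.add_self_eq_zero]
  · simp [basis_x_apply, h, Ne.symm h, CharTwo.add_self_eq_zero]

lemma Tv_basis_pair_basis (g : ℕ) (p q i : Fin g) :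
    Tv g (basis_x g p + basis_x g q) (basis_x g i) = basis_x g (Equiv.swap p q i) := by
  rw [Tv_apply, Bform_add_right, Bform_basis_right, Bform_basis_right]
  by_cases hpq : p = q
  · subst hpq
    simp [CharTwo.add_self_eq_zero]
  by_cases hp : i = p
  · subst hp
    simp [basis_x, Ne.symm hpq]
    rw [← add_assoc, Vg_add_self, zero_add]
  by_cases hq : i = q
  · subst hq
    simp [basis_x, hpq]
    rw [add_comm, Vg_add_add_cancel]
  rw [Equiv.swap_apply_of_ne_of_ne hp hq]
  simp [basis_x, Ne.symm hp, Ne.symm hq]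

lemma inGenGroup_Tv_add_two (g i : ℕ) (h : i + 2 < g) :
    InGenGroup g (Tv g (basis_x g ⟨i, by omega⟩ + basis_x g ⟨i + 2, h⟩)) :=
  ⟨TvUnit g _ (Bform_basis_pair_self g _ _), Subgroup.subset_closure (Or.inl ⟨i, h, rfl⟩), rfl⟩

lemma inGenGroup_Tv_add_two_mul (g k i : ℕ) (h : i + 2 * k < g) :
    InGenGroup g (Tv g (basis_x g ⟨i, by omega⟩ + basis_x g ⟨i + 2 * k, h⟩)) := by
  induction k with
  | zero =>
    simp only [mul_zero, add_zero, Vg_add_self, Tv_zero]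
    exact InGenGroup.one g
  | succ k ih =>
    have hk := inGenGroup_Tv_add_two g (i + 2 * k) (by omega)
    by_cases hk0 : k = 0
    · subst hk0
      exact inGenGroup_Tv_add_two g i (by omega)
    have := (hk.Tv_iff (isBIsometry_Tv g _ (Bform_basis_pair_self g _ _)) _).1 (ih (by omega))
    rw [map_add, Tv_basis_pair_basis, Tv_basis_pair_basis, Equiv.swap_apply_left,
      Equiv.swap_apply_of_ne_of_ne (by simp; omega) (by simp; omega)] at this
    exact this

lemma inGenGroup_Tv_basis_pair (g : ℕ) (p q : Fin g) (h : p.val % 2 = q.val % 2) :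
    InGenGroup g (Tv g (basis_x g p + basis_x g q)) := by
  wlog hpq : p ≤ q generalizing p q
  · rw [add_comm]
    exact this q p h.symm (by omega)
  have hpq' : p.val ≤ q.val := hpq
  have e : q = ⟨p.val + 2 * ((q.val - p.val) / 2), by omega⟩ := by
    ext
    simp only
    omega
  rw [e]
  exact inGenGroup_Tv_add_two_mul g _ p.val _

/-- The composite `T_{a+b} ∘ T_{c+d} ∘ T_{a+b+c+d}`. -/
def Tcomp (g : ℕ) (a b c d : Vg g) : Module.End (ZMod 2) (Vg g) :=
  Tv g (a + b) * Tv g (c + d) * Tv g (a + b + c + d)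

lemma IsBIsometry.mul_Tcomp {g : ℕ} {f : Module.End (ZMod 2) (Vg g)} (hf : IsBIsometry g f)
    (a b c d : Vg g) : f * Tcomp g a b c d = Tcomp g (f a) (f b) (f c) (f d) * f := by
  simp only [Tcomp, mul_assoc]
  rw [← map_add, ← map_add, ← map_add, ← map_add, ← hf.mul_Tv, ← mul_assoc f, hf.mul_Tv, mul_assoc,
    ← mul_assoc f, hf.mul_Tv, mul_assoc]

lemma Bform_quad_self {g : ℕ} {a b c d : Vg g} (hab : Bform g (a + b) (a + b) = 0)
    (hcd : Bform g (c + d) (c + d) = 0) :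
    Bform g (a + b + c + d) (a + b + c + d) = 0 := by
  rw [add_assoc (a + b), Bform_add_left, Bform_add_right, Bform_add_right _ (c + d), hab, hcd,
    Bform_comm g (c + d), zero_add, add_zero, CharTwo.add_self_eq_zero]

lemma isBIsometry_Tcomp {g : ℕ} {a b c d : Vg g} (hab : Bform g (a + b) (a + b) = 0)
    (hcd : Bform g (c + d) (c + d) = 0) : IsBIsometry g (Tcomp g a b c d) :=
  ((isBIsometry_Tv g _ hab).mul (isBIsometry_Tv g _ hcd)).mul
    (isBIsometry_Tv g _ (Bform_quad_self hab hcd))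

lemma Tcomp_apply {g : ℕ} {a b c d : Vg g} (hab : Bform g (a + b) (a + b) = 0)
    (hcd : Bform g (c + d) (c + d) = 0) (habcd : Bform g (c + d) (a + b) = 0) (v : Vg g) :
    Tcomp g a b c d v = v + Bform g v (a + b + c + d) • (a + b + c + d) +
      Bform g v (c + d) • (c + d) + Bform g v (a + b) • (a + b) := by
  simp only [Tcomp, Module.End.mul_apply, Tv_apply]
  rw [add_assoc (a + b)]
  generalize a + b = p at *
  generalize c + d = q at *
  simp only [Bform_add_left, Bform_smul_left, hab, hcd, habcd, Bform_comm g p q, add_zero,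
    mul_zero]

lemma inGenGroup_Tcomp_swap {g : ℕ} {i j k l : Fin g}
    (h : InGenGroup g (Tcomp g (basis_x g i) (basis_x g j) (basis_x g k) (basis_x g l)))
    (p q : Fin g) (hpq : p.val % 2 = q.val % 2) :
    InGenGroup g (Tcomp g (basis_x g (Equiv.swap p q i)) (basis_x g (Equiv.swap p q j))
      (basis_x g (Equiv.swap p q k)) (basis_x g (Equiv.swap p q l))) := by
  have := ((inGenGroup_Tv_basis_pair g p q hpq).congr_of_semiconj
    ((isBIsometry_Tv g _ (Bform_basis_pair_self g p q)).mul_Tcomp _ _ _ _)).1 h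
  simpa only [Tv_basis_pair_basis] using this

lemma inGenGroup_Tcomp_consecutive (g : ℕ) (hg : 3 < g) :
    InGenGroup g (Tcomp g (basis_x g ⟨0, by omega⟩) (basis_x g ⟨1, by omega⟩)
      (basis_x g ⟨2, by omega⟩) (basis_x g ⟨3, hg⟩)) :=
  ⟨TvUnit g _ (Bform_basis_pair_self g _ _) * TvUnit g _ (Bform_basis_pair_self g _ _) *
    TvUnit g _ (Bform_quad_self (Bform_basis_pair_self g _ _) (Bform_basis_pair_self g _ _)),
    Subgroup.subset_closure (Or.inr ⟨0, hg, rfl⟩), rfl⟩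

lemma swap_val_mod_two {g : ℕ} {p q : Fin g} (hpq : p.val % 2 = q.val % 2) (i : Fin g) :
    (Equiv.swap p q i).val % 2 = i.val % 2 := by
  rw [Equiv.swap_apply_def]
  split_ifs with h h' <;> simp_all

lemma inGenGroup_Tcomp_basis {g : ℕ} {i j k l : Fin g} (hi : i.val % 2 = 0) (hj : j.val % 2 = 1)
    (hk : k.val % 2 = 0) (hl : l.val % 2 = 1) (hik : i ≠ k) (hjl : j ≠ l) :
    InGenGroup g (Tcomp g (basis_x g i) (basis_x g j) (basis_x g k) (basis_x g l)) := by
  have hik' : i.val ≠ k.val := fun h => hik (Fin.ext h)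
  have hjl' : j.val ≠ l.val := fun h => hjl (Fin.ext h)
  have fix : ∀ {p q r : Fin g}, p.val % 2 = q.val % 2 → r.val % 2 ≠ q.val % 2 →
      Equiv.swap p q r = r := by
    intro p q r hpq hr
    exact Equiv.swap_apply_of_ne_of_ne (by rintro rfl; exact hr hpq) (by rintro rfl; exact hr rfl)
  have hg : 3 < g := by omega
  have base := inGenGroup_Tcomp_consecutive g hg
  -- Move the two even positions to `i` and `k`.
  have h0 : (⟨0, by omega⟩ : Fin g).val % 2 = i.val % 2 := by simp [hi]
  have s1 := inGenGroup_Tcomp_swap base ⟨0, by omega⟩ i h0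
  rw [Equiv.swap_apply_left, fix (r := ⟨1, by omega⟩) h0 (by simp [hi]),
    fix (r := ⟨3, by omega⟩) h0 (by simp [hi])] at s1
  have hs := swap_val_mod_two h0 ⟨2, by omega⟩
  have hsi : i ≠ Equiv.swap (⟨0, by omega⟩ : Fin g) i ⟨2, by omega⟩ := by
    conv_lhs => rw [← Equiv.swap_apply_left (⟨0, by omega⟩ : Fin g) i]
    exact fun h => by simpa using (Equiv.injective _ h)
  generalize Equiv.swap (⟨0, by omega⟩ : Fin g) i ⟨2, by omega⟩ = s at *
  have hsk : s.val % 2 = k.val % 2 := by simpa [hk] using hs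
  have s2 := inGenGroup_Tcomp_swap s1 s k hsk
  rw [Equiv.swap_apply_left, Equiv.swap_apply_of_ne_of_ne hsi hik,
    fix (r := ⟨1, by omega⟩) hsk (by simp [hk]),
    fix (r := ⟨3, by omega⟩) hsk (by simp [hk])] at s2
  -- Move the two odd positions to `j` and `l`.
  have h1 : (⟨1, by omega⟩ : Fin g).val % 2 = j.val % 2 := by simp [hj]
  have s3 := inGenGroup_Tcomp_swap s2 ⟨1, by omega⟩ j h1
  rw [Equiv.swap_apply_left, fix (r := i) h1 (by omega), fix (r := k) h1 (by omega)] at s3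
  have ht := swap_val_mod_two h1 ⟨3, by omega⟩
  have htj : j ≠ Equiv.swap (⟨1, by omega⟩ : Fin g) j ⟨3, by omega⟩ := by
    conv_lhs => rw [← Equiv.swap_apply_left (⟨1, by omega⟩ : Fin g) j]
    exact fun h => by simpa using (Equiv.injective _ h)
  generalize Equiv.swap (⟨1, by omega⟩ : Fin g) j ⟨3, by omega⟩ = t at *
  have htl : t.val % 2 = l.val % 2 := by simpa [hl] using ht
  have s4 := inGenGroup_Tcomp_swap s3 t l htl
  rwa [Equiv.swap_apply_left, Equiv.swap_apply_of_ne_of_ne htj hjl,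
    fix (r := i) htl (by omega), fix (r := k) htl (by omega)] at s4

/-- How the composite of basis transvections acts on a vector. -/
lemma Tcomp_basis_apply {g : ℕ} {i j k l : Fin g} (hi : i.val % 2 = 0) (hj : j.val % 2 = 1)
    (hk : k.val % 2 = 0) (hl : l.val % 2 = 1) (hik : i ≠ k) (hjl : j ≠ l) (v : Vg g) :
    Tcomp g (basis_x g i) (basis_x g j) (basis_x g k) (basis_x g l) v =
      v + (v i + v j + v k + v l) •
        (basis_x g i + basis_x g j + basis_x g k + basis_x g l) +
      (v k + v l) • (basis_x g k + basis_x g l) + (v i + v j) • (basis_x g i + basis_x g j) := by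
  have hil : i ≠ l := by rintro rfl; omega
  have hjk : j ≠ k := by rintro rfl; omega
  rw [Tcomp_apply (Bform_basis_pair_self g i j) (Bform_basis_pair_self g k l)]
  · simp only [Bform_add_right, Bform_basis_right]
  · simp only [Bform_add_right, Bform_basis_right]
    simp [basis_x_apply, hik, hjl, hil, hjk]

lemma inGenGroup_Tv_of_add_pair {g : ℕ} {i j k l : Fin g} (hi : i.val % 2 = 0)
    (hj : j.val % 2 = 1) (hk : k.val % 2 = 0) (hl : l.val % 2 = 1) (hik : i ≠ k) (hjl : j ≠ l)
    {a : Vg g} (hai : a i = 1) (haj : a j = 1) (hakl : a k + a l = 1)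
    (h : InGenGroup g (Tv g (a + basis_x g i + basis_x g j))) : InGenGroup g (Tv g a) := by
  rw [(inGenGroup_Tcomp_basis hi hj hk hl hik hjl).Tv_iff
    (isBIsometry_Tcomp (Bform_basis_pair_self g _ _) (Bform_basis_pair_self g _ _)),
    Tcomp_basis_apply hi hj hk hl hik hjl, add_assoc (a i + a j), hakl, hai, haj,
    CharTwo.add_self_eq_zero, zero_add, one_smul, one_smul, zero_smul, add_zero,
    add_assoc (basis_x g i + basis_x g j), ← add_assoc a, Vg_add_add_cancel, ← add_assoc]
  exact h

lemma inGenGroup_Tv_of_add_quad {g : ℕ} {i j k l : Fin g} (hi : i.val % 2 = 0)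
    (hj : j.val % 2 = 1) (hk : k.val % 2 = 0) (hl : l.val % 2 = 1) (hik : i ≠ k) (hjl : j ≠ l)
    {a : Vg g} (haij : a i + a j = 1) (hakl : a k + a l = 1)
    (h : InGenGroup g (Tv g (a + basis_x g i + basis_x g k + basis_x g j + basis_x g l))) :
    InGenGroup g (Tv g a) := by
  rw [(inGenGroup_Tcomp_basis hi hj hk hl hik hjl).Tv_iff
    (isBIsometry_Tcomp (Bform_basis_pair_self g _ _) (Bform_basis_pair_self g _ _)),
    Tcomp_basis_apply hi hj hk hl hik hjl, add_assoc (a i + a j), hakl, haij,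
    CharTwo.add_self_eq_zero, zero_smul, add_zero, one_smul, one_smul]
  convert h using 2
  abel

/-- The number of indices of residue `r` modulo 2 in the support of `a`. -/
def lenMod (g r : ℕ) (a : Vg g) : ℕ :=
  (Finset.univ.filter fun i : Fin g => a i = 1 ∧ i.val % 2 = r).card

lemma lenMod_add_basis_of_one {g : ℕ} (r : ℕ) {a : Vg g} {i : Fin g} (h : a i = 1) :
    lenMod g r (a + basis_x g i) + (if i.val % 2 = r then 1 else 0) = lenMod g r a := by
  have e : (Finset.univ.filter fun j : Fin g => (a + basis_x g i) j = 1 ∧ j.val % 2 = r) =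
      (Finset.univ.filter fun j : Fin g => a j = 1 ∧ j.val % 2 = r).erase i := by
    ext j
    simp only [Finset.mem_erase, Finset.mem_filter, Finset.mem_univ, true_and]
    by_cases hj : j = i
    · subst hj
      simp [basis_x, h, CharTwo.add_self_eq_zero]
    · simp [basis_x, hj]
  unfold lenMod
  rw [e]
  split_ifs with hr
  · exact Finset.card_erase_add_one (by simp [h, hr])
  · rw [Finset.erase_eq_of_notMem (by simp [hr]), add_zero]

lemma lenMod_add_basis_of_zero {g : ℕ} (r : ℕ) {a : Vg g} {i : Fin g} (h : a i = 0) :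
    lenMod g r (a + basis_x g i) = lenMod g r a + (if i.val % 2 = r then 1 else 0) := by
  have := lenMod_add_basis_of_one r (a := a + basis_x g i) (i := i) (by simp [basis_x, h])
  rw [Vg_add_add_cancel] at this
  exact this.symm

lemma add_basis_apply_of_ne {g : ℕ} (a : Vg g) {i j : Fin g} (h : j ≠ i) :
    (a + basis_x g i) j = a j := by
  simp [basis_x, h]

lemma card_filter_mod_two (g : ℕ) :
    (Finset.univ.filter fun i : Fin g => i.val % 2 = 0).card = (g + 1) / 2 ∧
      (Finset.univ.filter fun i : Fin g => i.val % 2 = 1).card = g / 2 := by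
  simp only [Finset.card_filter]
  induction g with
  | zero => simp
  | succ g ih =>
    simp only [Fin.sum_univ_castSucc, Fin.val_castSucc, ih.1, ih.2, Fin.val_last]
    split_ifs <;> omega

lemma lenMod_add_card_zero (g r : ℕ) (a : Vg g) :
    lenMod g r a + (Finset.univ.filter fun i : Fin g => a i = 0 ∧ i.val % 2 = r).card =
      (Finset.univ.filter fun i : Fin g => i.val % 2 = r).card := by
  have hz : ∀ x : ZMod 2, x = 0 ↔ ¬ x = 1 := by decide
  rw [← Finset.card_filter_add_card_filter_not
    (s := Finset.univ.filter fun i : Fin g => i.val % 2 = r) (fun i : Fin g => a i = 1),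
    Finset.filter_filter, Finset.filter_filter]
  simp only [lenMod, hz, and_comm]

lemma exists_one_of_lenMod {g r : ℕ} {a : Vg g} (h : 1 ≤ lenMod g r a) :
    ∃ i, a i = 1 ∧ i.val % 2 = r := by
  obtain ⟨i, hi⟩ := Finset.card_pos.1 h
  exact ⟨i, by simpa using hi⟩

lemma exists_two_of_lenMod {g r : ℕ} {a : Vg g} (h : 2 ≤ lenMod g r a) :
    ∃ i k, i ≠ k ∧ (a i = 1 ∧ i.val % 2 = r) ∧ (a k = 1 ∧ k.val % 2 = r) := by
  obtain ⟨i, hi, k, hk, hne⟩ := Finset.one_lt_card.1 h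
  exact ⟨i, k, hne, by simpa using hi, by simpa using hk⟩

lemma exists_zero_of_lenMod {g r : ℕ} {a : Vg g}
    (h : lenMod g r a < (Finset.univ.filter fun i : Fin g => i.val % 2 = r).card) :
    ∃ i, a i = 0 ∧ i.val % 2 = r := by
  rw [← lenMod_add_card_zero g r a] at h
  obtain ⟨i, hi⟩ := Finset.card_pos.1 (pos_of_lt_add_right h)
  exact ⟨i, by simpa using hi⟩

lemma exists_two_zero_of_lenMod {g r : ℕ} {a : Vg g}
    (h : lenMod g r a + 2 ≤ (Finset.univ.filter fun i : Fin g => i.val % 2 = r).card) :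
    ∃ i k, i ≠ k ∧ (a i = 0 ∧ i.val % 2 = r) ∧ (a k = 0 ∧ k.val % 2 = r) := by
  rw [← lenMod_add_card_zero g r a] at h
  obtain ⟨i, hi, k, hk, hne⟩ := Finset.one_lt_card.1 (Nat.le_of_add_le_add_left h)
  exact ⟨i, k, hne, by simpa using hi, by simpa using hk⟩

lemma eq_zero_of_lenMod {g : ℕ} {a : Vg g} (h0 : lenMod g 0 a = 0) (h1 : lenMod g 1 a = 0) :
    a = 0 := by
  ext i
  have hz : ∀ x : ZMod 2, ¬ x = 1 → x = 0 := by decide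
  refine hz _ fun hi => ?_
  rcases Nat.mod_two_eq_zero_or_one i.val with hr | hr
  · exact Finset.filter_eq_empty_iff.1 (Finset.card_eq_zero.1 h0) (Finset.mem_univ i) ⟨hi, hr⟩
  · exact Finset.filter_eq_empty_iff.1 (Finset.card_eq_zero.1 h1) (Finset.mem_univ i) ⟨hi, hr⟩

lemma lenMod_add_pair_of_one {g : ℕ} (r : ℕ) {a : Vg g} {i j : Fin g} (hij : i ≠ j)
    (hi : a i = 1) (hj : a j = 1) :
    lenMod g r (a + basis_x g i + basis_x g j) + (if j.val % 2 = r then 1 else 0) +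
      (if i.val % 2 = r then 1 else 0) = lenMod g r a := by
  rw [lenMod_add_basis_of_one r (by rwa [add_basis_apply_of_ne a hij.symm]),
    lenMod_add_basis_of_one r hi]

lemma lenMod_add_pair_of_zero {g : ℕ} (r : ℕ) {a : Vg g} {i j : Fin g} (hij : i ≠ j)
    (hi : a i = 0) (hj : a j = 0) :
    lenMod g r (a + basis_x g i + basis_x g j) = lenMod g r a + (if i.val % 2 = r then 1 else 0) +
      (if j.val % 2 = r then 1 else 0) := by
  rw [lenMod_add_basis_of_zero r (by rwa [add_basis_apply_of_ne a hij.symm]),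
    lenMod_add_basis_of_zero r hi]

/-- A vector whose support consists of two indices of the same parity. -/
lemma inGenGroup_Tv_of_lenMod_two {g r : ℕ} {a : Vg g} (h : lenMod g r a = 2)
    (h' : ∀ s, s ≠ r → lenMod g s a = 0) : InGenGroup g (Tv g a) := by
  obtain ⟨i, k, hik, ⟨hi, hir⟩, hk, hkr⟩ := exists_two_of_lenMod h.ge
  have e : ∀ s, lenMod g s (a + basis_x g i + basis_x g k) = 0 := by
    intro s
    have := lenMod_add_pair_of_one s hik hi hk
    by_cases hs : s = r
    · subst hs
      simp only [hir, hkr, if_true] at this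
      omega
    · have := h' s hs
      omega
  have e' := eq_zero_of_lenMod (e 0) (e 1)
  rw [add_assoc] at e'
  have : a = basis_x g i + basis_x g k := by
    rw [← Vg_add_add_cancel g a (basis_x g i + basis_x g k), e', zero_add]
  rw [this]
  exact inGenGroup_Tv_basis_pair g i k (hir.trans hkr.symm)

theorem inGenGroup_Tv_of_lenMod {g : ℕ} (a : Vg g)
    (h : (lenMod g 0 a + 2) % 4 = lenMod g 1 a % 4) : InGenGroup g (Tv g a) := by
  induction hn : lenMod g 0 a + lenMod g 1 a + max (lenMod g 0 a) (lenMod g 1 a)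
    using Nat.strong_induction_on generalizing a with
  | _ n ih =>
  subst hn
  obtain ⟨c0, c1⟩ := card_filter_mod_two g
  have z0 := lenMod_add_card_zero g 0 a
  have z1 := lenMod_add_card_zero g 1 a
  have reduce_pair : ∀ i j k l : Fin g, i.val % 2 = 0 → j.val % 2 = 1 → k.val % 2 = 0 →
      l.val % 2 = 1 → i ≠ k → j ≠ l → a i = 1 → a j = 1 → a k + a l = 1 →
      InGenGroup g (Tv g a) := by
    intro i j k l hi hj hk hl hik hjl hai haj hakl
    have hij : i ≠ j := by rintro rfl; omega
    have e0 := lenMod_add_pair_of_one 0 hij hai haj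
    have e1 := lenMod_add_pair_of_one 1 hij hai haj
    simp only [hi, hj, if_true, one_ne_zero, zero_ne_one, if_false] at e0 e1
    exact inGenGroup_Tv_of_add_pair hi hj hk hl hik hjl hai haj hakl
      (ih _ (by omega) _ (by omega) rfl)
  by_cases hA : 2 ≤ lenMod g 0 a ∧ 1 ≤ lenMod g 1 a ∧ lenMod g 1 a < g / 2
  · obtain ⟨i, k, hik, ⟨hai, hi⟩, hak, hk⟩ := exists_two_of_lenMod hA.1
    obtain ⟨j, haj, hj⟩ := exists_one_of_lenMod hA.2.1
    obtain ⟨l, hal, hl⟩ := exists_zero_of_lenMod (hA.2.2.trans_eq c1.symm)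
    exact reduce_pair i j k l hi hj hk hl hik (by rintro rfl; simp [hal] at haj) hai haj
      (by simp [hak, hal])
  by_cases hB : 1 ≤ lenMod g 0 a ∧ 2 ≤ lenMod g 1 a ∧ lenMod g 0 a < (g + 1) / 2
  · obtain ⟨i, hai, hi⟩ := exists_one_of_lenMod hB.1
    obtain ⟨j, l, hjl, ⟨haj, hj⟩, hal, hl⟩ := exists_two_of_lenMod hB.2.1
    obtain ⟨k, hak, hk⟩ := exists_zero_of_lenMod (hB.2.2.trans_eq c0.symm)
    exact reduce_pair i j k l hi hj hk hl (by rintro rfl; simp [hak] at hai) hjl hai haj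
      (by simp [hak, hal])
  have reduce_quad : ∀ r s : ℕ, r < 2 → s < 2 → r ≠ s → lenMod g s a = 0 → 6 ≤ lenMod g r a →
      InGenGroup g (Tv g a) := by
    intro r s hr hs hrs h0 h6
    obtain ⟨i, k, hik, ⟨hai, hi⟩, hak, hk⟩ := exists_two_of_lenMod (le_trans (by omega) h6)
    obtain ⟨j, l, hjl, ⟨haj, hj⟩, hal, hl⟩ := exists_two_zero_of_lenMod (r := s) (a := a) (by
      interval_cases r <;> interval_cases s <;> omega)
    have hij : j ≠ i := by rintro rfl; omega
    have hkj : j ≠ k := by rintro rfl; omega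
    have hil : l ≠ i := by rintro rfl; omega
    have hkl : l ≠ k := by rintro rfl; omega
    have e := fun t => lenMod_add_pair_of_one t hik hai hak
    have e' := fun t => lenMod_add_pair_of_zero t hjl
      (a := a + basis_x g i + basis_x g k)
      (by rwa [add_basis_apply_of_ne _ hkj, add_basis_apply_of_ne _ hij])
      (by rwa [add_basis_apply_of_ne _ hkl, add_basis_apply_of_ne _ hil])
    have e0 := e 0
    have e1 := e 1
    have e0' := e' 0
    have e1' := e' 1
    rw [hi, hk] at e0 e1
    rw [hj, hl] at e0' e1'
    have key : InGenGroup g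
        (Tv g (a + basis_x g i + basis_x g k + basis_x g j + basis_x g l)) := by
      refine ih _ ?_ _ ?_ rfl <;> interval_cases r <;> interval_cases s <;> simp at * <;> omega
    obtain rfl | rfl : r = 0 ∨ r = 1 := by omega
    · obtain rfl : s = 1 := by omega
      exact inGenGroup_Tv_of_add_quad hi hj hk hl hik hjl (by simp [hai, haj])
        (by simp [hak, hal]) key
    · obtain rfl : s = 0 := by omega
      refine inGenGroup_Tv_of_add_quad hj hi hl hk hjl hik (by simp [hai, haj])
        (by simp [hak, hal]) ?_
      convert key using 2
      abel
  have other : ∀ r s, s ≠ r → lenMod g (1 - r) a = 0 → r < 2 → lenMod g s a = 0 := by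
    intro r s hsr h0 hr
    by_cases hs : s < 2
    · obtain rfl : s = 1 - r := by omega
      exact h0
    · exact Finset.card_eq_zero.2 (Finset.filter_eq_empty_iff.2 fun i _ hi => by omega)
  rcases Nat.eq_zero_or_pos (lenMod g 1 a) with h1 | h1
  · by_cases h2 : lenMod g 0 a = 2
    · exact inGenGroup_Tv_of_lenMod_two h2 fun s hs => other 0 s hs h1 (by omega)
    · exact reduce_quad 0 1 (by omega) (by omega) (by omega) h1 (by omega)
  rcases Nat.eq_zero_or_pos (lenMod g 0 a) with h0 | h0
  · by_cases h2 : lenMod g 1 a = 2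
    · exact inGenGroup_Tv_of_lenMod_two h2 fun s hs => other 1 s hs h0 (by omega)
    · exact reduce_quad 1 0 (by omega) (by omega) (by omega) h0 (by omega)
  omega

/-- If `q(a) = 2` then `T_a` lies in the subgroup generated by the listed
transvections and composites. -/
theorem stmt13 (g : ℕ) (hg : 1 ≤ g) (a : Vg g) (ha : qform g a = 2) :
    ∃ u ∈ Subgroup.closure (genSet g),
      (u : Module.End (ZMod 2) (Vg g)) = Tv g a := by
  apply inGenGroup_Tv_of_lenMod
  have h : ((lenMod g 0 a : ℕ) : ZMod 4) = ((lenMod g 1 a + 2 : ℕ) : ZMod 4) := by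
    push_cast
    exact (sub_eq_iff_eq_add.1 ha).trans (add_comm _ _)
  have := (ZMod.natCast_eq_natCast_iff' _ _ _).1 h
  omega
end
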